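/- Let N ≥ 1 be an integer, α > 0, and let u₀ : ℝ^N → [0,∞) be measurable. Assume limsup_{t ↓ 0} (αt)^{1/α} · ess sup_{x ∈ ℝ^N} ∫_{ℝ^N} G(t,x,y) u₀(y) dy > 1. Then for no T > 0 does there exist a nonnegative regular solution of u_t = Δu + u^{α+1} on (0,T) × ℝ^N with initial value u₀; that is, there is no function u : (0,T) × ℝ^N → [0,∞) which belongs to C((0,T), C₀(ℝ^N)), is C¹ in t and C² in x on (0,T) × ℝ^N with ∂_t u = Δu + u^{α+1} pointwise there, and for which there exists a sequence t_n ↓ 0 with u(t_n, x) → u₀(x) for almost every x ∈ ℝ^N. -/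

import Mathlib

open MeasureTheory Real Set Filter ENNReal

/-- The Gaussian heat kernel `G(t,x,y) = (4πt)^{-N/2} exp(-|x-y|²/(4t))` on `ℝ^N`. -/
noncomputable def heatKernel (N : ℕ) (t : ℝ) (x y : EuclideanSpace ℝ (Fin N)) : ℝ :=
  (4 * π * t) ^ (-(N : ℝ) / 2) * Real.exp (-‖x - y‖ ^ 2 / (4 * t))

/-- The Laplacian of `f : ℝ^N → ℝ`, as the sum of the pure second partial derivatives. -/
noncomputable def lap (N : ℕ) (f : EuclideanSpace ℝ (Fin N) → ℝ)
    (x : EuclideanSpace ℝ (Fin N)) : ℝ :=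
  ∑ i : Fin N, iteratedFDeriv ℝ 2 f x ![EuclideanSpace.single i 1, EuclideanSpace.single i 1]

lemma tangent_ineq {α c u p : ℝ} (hα : 0 < α) (hc : 0 ≤ c) (hu : 0 ≤ u) (hp : 0 ≤ p) :
    u * (1 + c * u ^ α) ^ (-(1 / α)) ≤
      (1 + c * p ^ α) ^ (-(1 / α) - 1) * (u + c * p ^ (α + 1)) := by
  rcases hu.eq_or_lt with rfl | hu
  · have : 0 ≤ c * p ^ (α + 1) := by positivity
    have h2 : 0 ≤ (1 + c * p ^ α) ^ (-(1 / α) - 1) := by positivity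
    simp only [zero_mul, zero_add]
    positivity
  have hua : 0 < u ^ α := rpow_pos_of_pos hu _
  have hB : 0 < 1 + c * u ^ α := by positivity
  have hq : 0 < 1 + c * p ^ α := by positivity
  have hcv := convexOn_rpow (p := 1 / α + 1) (by linarith [one_div_pos.2 hα])
  have key := hcv.2 (show (1 : ℝ) ∈ Ici 0 by simp)
    (show (p / u) ^ α ∈ Ici 0 by simp only [mem_Ici]; positivity)
    (show 0 ≤ 1 / (1 + c * u ^ α) by positivity)
    (show 0 ≤ c * u ^ α / (1 + c * u ^ α) by positivity) (by field_simp)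
  simp only [smul_eq_mul] at key
  have e1 : 1 / (1 + c * u ^ α) * 1 + c * u ^ α / (1 + c * u ^ α) * (p / u) ^ α
      = (1 + c * p ^ α) / (1 + c * u ^ α) := by
    rw [div_rpow hp hu.le]; field_simp
  have e2 : ((p / u) ^ α) ^ (1 / α + 1) = p ^ (α + 1) / (u ^ α * u) := by
    rw [← rpow_mul (by positivity), show α * (1 / α + 1) = α + 1 by field_simp; ring,
      div_rpow hp hu.le, rpow_add_one hu.ne']
  rw [e1, e2, Real.one_rpow, div_rpow hq.le hB.le, rpow_add_one hB.ne'] at key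
  have e3 : (1 + c * p ^ α) ^ (-(1 / α) - 1) = ((1 + c * p ^ α) ^ (1 / α + 1))⁻¹ := by
    rw [← rpow_neg hq.le]; ring_nf
  rw [e3, rpow_neg hB.le]
  set Q := (1 + c * p ^ α) ^ (1 / α + 1)
  have hQ : 0 < Q := by positivity
  set B := (1 + c * u ^ α)
  set b := B ^ (1 / α)
  have hb : 0 < b := by positivity
  have e4 : 1 / B * 1 + c * u ^ α / B * (p ^ (α + 1) / (u ^ α * u))
      = (u + c * p ^ (α + 1)) / (u * B) := by field_simp
  rw [e4, div_le_div_iff₀ (by positivity) (by positivity)] at key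
  rw [← div_eq_mul_inv, inv_mul_eq_div, div_le_div_iff₀ hb hQ]
  have : B * (u * Q) ≤ B * ((u + c * p ^ (α + 1)) * b) := by linarith
  exact le_of_mul_le_mul_left this hB

lemma tangent_eq {α c p : ℝ} (hα : 0 < α) (hc : 0 ≤ c) (hp : 0 ≤ p) :
    p * (1 + c * p ^ α) ^ (-(1 / α)) =
      (1 + c * p ^ α) ^ (-(1 / α) - 1) * (p + c * p ^ (α + 1)) := by
  have hq : 0 < 1 + c * p ^ α := by positivity
  rw [rpow_sub_one hq.ne', rpow_add_one' hp (by positivity)]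
  field_simp

lemma z_bound {α t u : ℝ} (hα : 0 < α) (ht : 0 < t) (hu : 0 ≤ u) :
    (α * t) ^ (1 / α) * (u * (1 + α * t * u ^ α) ^ (-(1 / α))) ≤ 1 := by
  have h0 : 0 ≤ u ^ α := by positivity
  have hB : 0 < 1 + α * t * u ^ α := by positivity
  have h1 : (α * t) ^ (1 / α) * u = (α * t * u ^ α) ^ (1 / α) := by
    rw [mul_rpow (by positivity) h0, ← rpow_mul hu, mul_one_div_cancel hα.ne', Real.rpow_one]
  rw [rpow_neg hB.le, ← mul_assoc, h1, ← div_eq_mul_inv]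
  apply div_le_one_of_le₀ _ (by positivity)
  apply rpow_le_rpow (by positivity) (by linarith) (by positivity)

lemma second_deriv_nonneg {φ φ' : ℝ → ℝ} {d : ℝ} (h1 : ∀ r, HasDerivAt φ (φ' r) r)
    (h2 : HasDerivAt φ' d 0) (hmin : ∀ r, φ 0 ≤ φ r) : 0 ≤ d := by
  by_contra hd
  push Not at hd
  have e : deriv φ = φ' := funext fun r => (h1 r).deriv
  have hlm : IsLocalMin φ 0 := Eventually.of_forall hmin
  have hlM : IsLocalMax φ 0 := isLocalMax_of_deriv_deriv_neg (by rw [e, h2.deriv]; exact hd)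
    hlm.deriv_eq_zero (h1 0).continuousAt
  have hc : φ =ᶠ[nhds 0] fun _ => φ 0 := by
    filter_upwards [hlM] with r hr using le_antisymm hr (hmin r)
  have h3 := hc.deriv.deriv_eq
  rw [e, h2.deriv] at h3
  simp at h3
  linarith

lemma deriv_nonpos_of_left_min {g : ℝ → ℝ} {d t : ℝ} (ht : 0 < t) (h : HasDerivAt g d t)
    (hmin : ∀ s ∈ Icc 0 t, g t ≤ g s) : d ≤ 0 := by
  by_contra hd
  push Not at hd
  have h1 := (hasDerivAt_iff_tendsto_slope.1 h).eventually (lt_mem_nhds hd)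
  have h2 : ∀ᶠ s in nhdsWithin t (Iio t), 0 < slope g t s :=
    h1.filter_mono (nhdsWithin_mono _ (by intro x hx; exact ne_of_lt hx))
  have h3 : ∀ᶠ s in nhdsWithin t (Iio t), s ∈ Ioo 0 t := Ioo_mem_nhdsLT ht
  obtain ⟨s, hs, hs2⟩ := (h2.and h3).exists
  rw [slope_def_field] at hs
  have := hmin s ⟨hs2.1.le, hs2.2.le⟩
  have h4 : (g s - g t) / (s - t) ≤ 0 :=
    div_nonpos_of_nonneg_of_nonpos (by linarith) (by linarith [hs2.2])
  linarith

lemma param_deriv {N : ℕ} {k k' : ℝ → EuclideanSpace ℝ (Fin N) → ℝ}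
    {f : EuclideanSpace ℝ (Fin N) → ℝ} (hf : Continuous f) (hfc : HasCompactSupport f)
    {r₀ δ : ℝ} (hδ : 0 < δ)
    (hk : ∀ r ∈ Icc (r₀ - δ) (r₀ + δ), Continuous (k r))
    (hk' : ContinuousOn (fun p : ℝ × EuclideanSpace ℝ (Fin N) => k' p.1 p.2)
      (Icc (r₀ - δ) (r₀ + δ) ×ˢ univ))
    (hd : ∀ r ∈ Icc (r₀ - δ) (r₀ + δ), ∀ y, HasDerivAt (fun r => k r y) (k' r y) r) :
    HasDerivAt (fun r => ∫ y, k r y * f y) (∫ y, k' r₀ y * f y) r₀ := by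
  have hn : Icc (r₀ - δ) (r₀ + δ) ∈ nhds r₀ := Icc_mem_nhds (by linarith) (by linarith)
  have hr0 : r₀ ∈ Icc (r₀ - δ) (r₀ + δ) := ⟨by linarith, by linarith⟩
  obtain ⟨C, hC⟩ := (isCompact_Icc.prod hfc).exists_bound_of_continuousOn
    (hk'.mono (prod_mono subset_rfl (subset_univ _)))
  have hk0 : Continuous (k' r₀) := by
    have := hk'.comp_continuous (f := fun y => (r₀, y)) (by fun_prop)
      (fun y => ⟨hr0, mem_univ _⟩)
    exact this
  refine (hasDerivAt_integral_of_dominated_loc_of_deriv_le (μ := volume)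
    (F := fun r y => k r y * f y) (F' := fun r y => k' r y * f y)
    (bound := fun y => C * ‖f y‖) hn ?_ ?_ ?_ ?_ ?_ ?_).2
  · filter_upwards [hn] with r hr using ((hk r hr).mul hf).aestronglyMeasurable
  · exact ((hk _ hr0).mul hf).integrable_of_hasCompactSupport hfc.mul_left
  · exact (hk0.mul hf).aestronglyMeasurable
  · refine Eventually.of_forall fun y r hr => ?_
    by_cases hy : y ∈ tsupport f
    · rw [norm_mul]
      exact mul_le_mul_of_nonneg_right (hC (r, y) ⟨hr, hy⟩) (norm_nonneg _)
    · simp [image_eq_zero_of_notMem_tsupport hy]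
  · exact ((hf.norm).integrable_of_hasCompactSupport hfc.norm).const_mul C
  · exact Eventually.of_forall fun y r hr => (hd r hr y).mul_const _

lemma heatKernel_deriv_t {N : ℕ} {t : ℝ} (ht : 0 < t) (x y : EuclideanSpace ℝ (Fin N)) :
    HasDerivAt (fun t => heatKernel N t x y)
      (heatKernel N t x y * (‖x - y‖ ^ 2 / (4 * t ^ 2) - N / (2 * t))) t := by
  unfold heatKernel
  have h1 : HasDerivAt (fun t : ℝ => (4 * π * t) ^ (-(N : ℝ) / 2))
      (4 * π * 1 * (-(N : ℝ) / 2) * (4 * π * t) ^ (-(N : ℝ) / 2 - 1)) t :=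
    ((hasDerivAt_id t).const_mul (4 * π)).rpow_const (Or.inl (by simp; positivity))
  have h2 : HasDerivAt (fun t : ℝ => Real.exp (-‖x - y‖ ^ 2 / (4 * t)))
      (Real.exp (-‖x - y‖ ^ 2 / (4 * t)) * (‖x - y‖ ^ 2 / (4 * t ^ 2))) t := by
    apply HasDerivAt.exp
    have := (((hasDerivAt_id t).const_mul 4).inv (by simp; positivity)).const_mul (-‖x - y‖ ^ 2)
    simp only [id] at this
    convert! this using 1
    field_simp
  convert! h1.mul h2 using 1
  rw [rpow_sub_one (by positivity)]
  field_simp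
  ring

lemma norm_line {N : ℕ} (w : EuclideanSpace ℝ (Fin N)) (i : Fin N) (r : ℝ) :
    ‖w + r • EuclideanSpace.single i (1 : ℝ)‖ ^ 2 = ‖w‖ ^ 2 + 2 * r * w i + r ^ 2 := by
  rw [norm_add_sq_real, inner_smul_right, norm_smul]
  simp [EuclideanSpace.inner_single_right, mul_assoc]

lemma norm_line_deriv {N : ℕ} (w : EuclideanSpace ℝ (Fin N)) (i : Fin N) (r : ℝ) :
    HasDerivAt (fun r : ℝ => ‖w + r • EuclideanSpace.single i (1 : ℝ)‖ ^ 2) (2 * w i + 2 * r) r := by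
  simp_rw [norm_line]
  have := ((((hasDerivAt_id r).const_mul 2).mul_const (w i)).const_add (‖w‖ ^ 2)).add
    ((hasDerivAt_id r).pow 2)
  convert! this using 1
  simp

lemma heatKernel_deriv_r {N : ℕ} {t : ℝ} (x y : EuclideanSpace ℝ (Fin N))
    (i : Fin N) (r : ℝ) :
    HasDerivAt (fun r : ℝ => heatKernel N t (x + r • EuclideanSpace.single i (1 : ℝ)) y)
      (heatKernel N t (x + r • EuclideanSpace.single i (1 : ℝ)) y *
        (-(2 * (x - y) i + 2 * r) / (4 * t))) r := by
  unfold heatKernel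
  simp_rw [add_sub_right_comm]
  have := ((((norm_line_deriv (x - y) i r).neg).div_const (4 * t)).exp).const_mul
    ((4 * π * t) ^ (-(N : ℝ) / 2))
  convert! this using 1
  simp only [Pi.neg_apply]
  ring

lemma heatKernel_deriv_rr {N : ℕ} {t : ℝ} (x y : EuclideanSpace ℝ (Fin N))
    (i : Fin N) (r : ℝ) :
    HasDerivAt (fun r : ℝ => heatKernel N t (x + r • EuclideanSpace.single i (1 : ℝ)) y *
        (-(2 * (x - y) i + 2 * r) / (4 * t)))
      (heatKernel N t (x + r • EuclideanSpace.single i (1 : ℝ)) y *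
        ((-(2 * (x - y) i + 2 * r) / (4 * t)) ^ 2 - 2 / (4 * t))) r := by
  have h : HasDerivAt (fun r : ℝ => (-(2 * (x - y) i + 2 * r) / (4 * t))) (- (2 * 1) / (4 * t)) r :=
    (((hasDerivAt_id r).const_mul 2).const_add (2 * (x - y) i)).neg.div_const (4 * t)
  convert! (heatKernel_deriv_r (t := t) x y i r).mul h using 1
  ring

/-- The heat flow of `f`, written so that it makes sense at `t = 0`. -/
noncomputable def heatV (N : ℕ) (f : EuclideanSpace ℝ (Fin N) → ℝ) (t : ℝ)
    (x : EuclideanSpace ℝ (Fin N)) : ℝ :=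
  ∫ ξ, heatKernel N 1 0 ξ * f (x + √t • ξ)

lemma hk_nonneg (N : ℕ) {t : ℝ} (ht : 0 ≤ t) (x y : EuclideanSpace ℝ (Fin N)) :
    0 ≤ heatKernel N t x y := by
  unfold heatKernel; positivity

lemma hk_continuous (N : ℕ) (t : ℝ) (x : EuclideanSpace ℝ (Fin N)) :
    Continuous (heatKernel N t x) := by
  unfold heatKernel; fun_prop

lemma hk_integral (N : ℕ) : ∫ ξ, heatKernel N 1 0 ξ = 1 := by
  unfold heatKernel
  rw [integral_const_mul]
  have := GaussianFourier.integral_rexp_neg_mul_sq_norm (V := EuclideanSpace ℝ (Fin N))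
    (b := 1 / 4) (by norm_num)
  have e : ∀ a : EuclideanSpace ℝ (Fin N), rexp (-‖0 - a‖ ^ 2 / (4 * 1))
      = rexp (-(1 / 4) * ‖a‖ ^ 2) := by
    intro a; rw [zero_sub, norm_neg]; ring_nf
  simp_rw [e]
  rw [this, finrank_euclideanSpace_fin, show π / (1 / 4) = 4 * π * 1 by ring,
    ← Real.rpow_add (by positivity)]
  rw [show -(N : ℝ) / 2 + N / 2 = 0 by ring, Real.rpow_zero]

lemma hk_integrable (N : ℕ) : Integrable (heatKernel N 1 0) := by
  by_contra h
  have := integral_undef h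
  rw [hk_integral] at this
  norm_num at this

lemma heatV_zero (N : ℕ) (f : EuclideanSpace ℝ (Fin N) → ℝ) (x : EuclideanSpace ℝ (Fin N)) :
    heatV N f 0 x = f x := by
  unfold heatV
  simp [integral_mul_const, hk_integral]

lemma heatV_continuous {N : ℕ} {f : EuclideanSpace ℝ (Fin N) → ℝ} (hf : Continuous f) {M : ℝ}
    (hM : ∀ x, ‖f x‖ ≤ M) :
    Continuous (fun p : ℝ × EuclideanSpace ℝ (Fin N) => heatV N f p.1 p.2) := by
  unfold heatV
  refine continuous_of_dominated (bound := fun ξ => heatKernel N 1 0 ξ * M) ?_ ?_ ?_ ?_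
  · intro p
    exact ((hk_continuous N 1 0).mul (by fun_prop)).aestronglyMeasurable
  · intro p
    refine Eventually.of_forall fun ξ => ?_
    rw [norm_mul, Real.norm_of_nonneg (hk_nonneg N zero_le_one _ _)]
    exact mul_le_mul_of_nonneg_left (hM _) (hk_nonneg N zero_le_one _ _)
  · exact (hk_integrable N).mul_const M
  · refine Eventually.of_forall fun ξ => ?_
    fun_prop

lemma heatV_le {N : ℕ} {f : EuclideanSpace ℝ (Fin N) → ℝ} {M : ℝ}
    (hM : ∀ x, ‖f x‖ ≤ M) (t : ℝ) (x : EuclideanSpace ℝ (Fin N)) : heatV N f t x ≤ M := by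
  unfold heatV
  have h := norm_integral_le_of_norm_le (f := fun ξ => heatKernel N 1 0 ξ * f (x + √t • ξ))
    ((hk_integrable N).mul_const M) (Eventually.of_forall fun ξ => by
      rw [norm_mul, Real.norm_of_nonneg (hk_nonneg N zero_le_one _ _)]
      exact mul_le_mul_of_nonneg_left (hM _) (hk_nonneg N zero_le_one _ _))
  rw [integral_mul_const, hk_integral, one_mul] at h
  exact (le_abs_self _).trans h

lemma heatV_eq {N : ℕ} (f : EuclideanSpace ℝ (Fin N) → ℝ) {t : ℝ} (ht : 0 < t)
    (x : EuclideanSpace ℝ (Fin N)) : heatV N f t x = ∫ y, heatKernel N t x y * f y := by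
  unfold heatV
  have hs : 0 < √t := Real.sqrt_pos.2 ht
  have e1 : ∀ ξ : EuclideanSpace ℝ (Fin N), heatKernel N 1 0 ξ * f (x + √t • ξ)
      = (fun η => heatKernel N 1 0 ((√t)⁻¹ • η) * f (x + η)) (√t • ξ) := by
    intro ξ; simp [smul_smul, inv_mul_cancel₀ hs.ne']
  simp_rw [e1]
  rw [Measure.integral_comp_smul volume
    (fun η : EuclideanSpace ℝ (Fin N) => heatKernel N 1 0 ((√t)⁻¹ • η) * f (x + η))]
  rw [← integral_add_left_eq_self (fun y => heatKernel N t x y * f y) x, smul_eq_mul,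
    ← integral_const_mul]
  congr 1
  ext η
  rw [← mul_assoc]
  congr 1
  unfold heatKernel
  rw [← mul_assoc]
  congr 1
  · rw [finrank_euclideanSpace_fin, abs_of_pos (by positivity), mul_rpow (by positivity) ht.le,
      mul_one, mul_comm, Real.sqrt_eq_rpow, ← Real.rpow_natCast, ← Real.rpow_mul ht.le,
      ← Real.rpow_neg ht.le]
    ring_nf
  · congr 1
    rw [zero_sub, norm_neg, norm_smul, sub_add_cancel_left, norm_neg, norm_inv,
      Real.norm_of_nonneg hs.le, mul_pow, inv_pow, Real.sq_sqrt ht.le]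
    field_simp

lemma heatV_deriv_t {N : ℕ} {f : EuclideanSpace ℝ (Fin N) → ℝ} (hf : Continuous f)
    (hfc : HasCompactSupport f) {t : ℝ} (ht : 0 < t) (x : EuclideanSpace ℝ (Fin N)) :
    HasDerivAt (fun t => heatV N f t x)
      (∫ y, heatKernel N t x y * (‖x - y‖ ^ 2 / (4 * t ^ 2) - N / (2 * t)) * f y) t := by
  have h := param_deriv (N := N) (k := fun t y => heatKernel N t x y)
    (k' := fun t y => heatKernel N t x y * (‖x - y‖ ^ 2 / (4 * t ^ 2) - N / (2 * t)))
    hf hfc (r₀ := t) (δ := t / 2) (by positivity) (fun r _ => hk_continuous N r x) ?_ ?_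
  · refine h.congr_of_eventuallyEq ?_
    filter_upwards [lt_mem_nhds ht] with s hs using heatV_eq f hs x
  · intro p hp
    have hp0 : 0 < p.1 := by have := hp.1.1; linarith
    have h4 : 4 * π * p.1 ≠ 0 := by positivity
    have h5 : 4 * p.1 ≠ 0 := by positivity
    have h6 : 4 * p.1 ^ 2 ≠ 0 := by positivity
    have h7 : 2 * p.1 ≠ 0 := by positivity
    apply ContinuousAt.continuousWithinAt
    unfold heatKernel
    apply ContinuousAt.mul
    · apply ContinuousAt.mul
      · exact ContinuousAt.rpow_const (by fun_prop) (Or.inl h4)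
      · apply ContinuousAt.rexp
        refine ContinuousAt.div ?_ ?_ ?_ <;> first | exact h5 | fun_prop
    · apply ContinuousAt.sub
      · refine ContinuousAt.div ?_ ?_ ?_ <;> first | exact h6 | fun_prop
      · refine ContinuousAt.div ?_ ?_ ?_ <;> first | exact h7 | fun_prop
  · intro r hr y
    exact heatKernel_deriv_t (by have := hr.1; linarith) x y

lemma heatV_deriv_r {N : ℕ} {f : EuclideanSpace ℝ (Fin N) → ℝ} (hf : Continuous f)
    (hfc : HasCompactSupport f) {t : ℝ} (ht : 0 < t) (x : EuclideanSpace ℝ (Fin N)) (i : Fin N)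
    (r : ℝ) :
    HasDerivAt (fun r : ℝ => heatV N f t (x + r • EuclideanSpace.single i (1 : ℝ)))
      (∫ y, heatKernel N t (x + r • EuclideanSpace.single i (1 : ℝ)) y *
        (-(2 * (x - y) i + 2 * r) / (4 * t)) * f y) r := by
  simp_rw [heatV_eq f ht]
  refine param_deriv (N := N)
    (k := fun r y => heatKernel N t (x + r • EuclideanSpace.single i (1 : ℝ)) y)
    (k' := fun r y => heatKernel N t (x + r • EuclideanSpace.single i (1 : ℝ)) y *
        (-(2 * (x - y) i + 2 * r) / (4 * t))) hf hfc (r₀ := r) (δ := 1) one_pos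
      (fun r _ => hk_continuous N t _) ?_ (fun r _ y => heatKernel_deriv_r x y i r)
  apply Continuous.continuousOn
  unfold heatKernel
  simp only [PiLp.sub_apply]
  fun_prop

lemma heatV_deriv_rr {N : ℕ} {f : EuclideanSpace ℝ (Fin N) → ℝ} (hf : Continuous f)
    (hfc : HasCompactSupport f) {t : ℝ} (x : EuclideanSpace ℝ (Fin N)) (i : Fin N)
    (r : ℝ) :
    HasDerivAt (fun r : ℝ => ∫ y, heatKernel N t (x + r • EuclideanSpace.single i (1 : ℝ)) y *
        (-(2 * (x - y) i + 2 * r) / (4 * t)) * f y)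
      (∫ y, heatKernel N t (x + r • EuclideanSpace.single i (1 : ℝ)) y *
        ((-(2 * (x - y) i + 2 * r) / (4 * t)) ^ 2 - 2 / (4 * t)) * f y) r := by
  refine param_deriv (N := N)
    (k := fun r y => heatKernel N t (x + r • EuclideanSpace.single i (1 : ℝ)) y *
        (-(2 * (x - y) i + 2 * r) / (4 * t)))
    (k' := fun r y => heatKernel N t (x + r • EuclideanSpace.single i (1 : ℝ)) y *
        ((-(2 * (x - y) i + 2 * r) / (4 * t)) ^ 2 - 2 / (4 * t))) hf hfc (r₀ := r) (δ := 1) one_pos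
      (fun r _ => ?_) ?_ (fun r _ y => heatKernel_deriv_rr x y i r)
  · unfold heatKernel
    simp only [PiLp.sub_apply]
    fun_prop
  apply Continuous.continuousOn
  unfold heatKernel
  simp only [PiLp.sub_apply]
  fun_prop

lemma heatV_lap {N : ℕ} {f : EuclideanSpace ℝ (Fin N) → ℝ} (hf : Continuous f)
    (hfc : HasCompactSupport f) {t : ℝ} (ht : 0 < t) (x : EuclideanSpace ℝ (Fin N)) :
    ∑ i : Fin N, (∫ y, heatKernel N t (x + (0 : ℝ) • EuclideanSpace.single i (1 : ℝ)) y *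
        ((-(2 * (x - y) i + 2 * 0) / (4 * t)) ^ 2 - 2 / (4 * t)) * f y) =
    ∫ y, heatKernel N t x y * (‖x - y‖ ^ 2 / (4 * t ^ 2) - N / (2 * t)) * f y := by
  rw [← integral_finsetSum]
  · congr 1
    ext y
    rw [← Finset.sum_mul]
    congr 1
    simp only [zero_smul, add_zero]
    rw [← Finset.mul_sum, Finset.sum_sub_distrib, EuclideanSpace.norm_sq_eq, Finset.sum_div]
    congr 2
    · apply Finset.sum_congr rfl
      intro i _
      rw [Real.norm_eq_abs, sq_abs]
      field_simp
      ring
    · simp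
      field_simp
      norm_num
  · intro i _
    refine Continuous.integrable_of_hasCompactSupport (Continuous.mul ?_ hf) hfc.mul_left
    unfold heatKernel
    simp only [PiLp.sub_apply]
    fun_prop

lemma line_deriv {N : ℕ} {g : EuclideanSpace ℝ (Fin N) → ℝ} (hg : ContDiff ℝ 2 g)
    (x e : EuclideanSpace ℝ (Fin N)) (r : ℝ) :
    HasDerivAt (fun r : ℝ => g (x + r • e)) (fderiv ℝ g (x + r • e) e) r := by
  have h1 : HasDerivAt (fun r : ℝ => x + r • e) e r := by
    simpa using ((hasDerivAt_id r).smul_const e).const_add x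
  exact ((hg.differentiable (by norm_num)) (x + r • e)).hasFDerivAt.comp_hasDerivAt r h1

lemma line_deriv2 {N : ℕ} {g : EuclideanSpace ℝ (Fin N) → ℝ} (hg : ContDiff ℝ 2 g)
    (x e : EuclideanSpace ℝ (Fin N)) :
    HasDerivAt (fun r : ℝ => fderiv ℝ g (x + r • e) e) (iteratedFDeriv ℝ 2 g x ![e, e]) 0 := by
  have h1 : HasDerivAt (fun r : ℝ => x + r • e) e 0 := by
    simpa using ((hasDerivAt_id (0 : ℝ)).smul_const e).const_add x
  have h2 : ContDiff ℝ 1 (fderiv ℝ g) := hg.fderiv_right (by norm_num)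
  have h3 := ((h2.differentiable (by norm_num)) (x + (0 : ℝ) • e)).hasFDerivAt.comp_hasDerivAt 0 h1
  have h4 := h3.clm_apply (hasDerivAt_const (0 : ℝ) e)
  rw [iteratedFDeriv_two_apply]
  simpa using h4

lemma comparison {N : ℕ} {α : ℝ} (hα : 0 < α) {t₀ : ℝ} (U : ℝ → EuclideanSpace ℝ (Fin N) → ℝ)
    (hUc : ContinuousOn (fun p : ℝ × EuclideanSpace ℝ (Fin N) => U p.1 p.2) (Icc 0 t₀ ×ˢ univ))
    (hU0 : ∀ t ∈ Icc 0 t₀, ∀ x, 0 ≤ U t x)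
    (hU2 : ∀ t ∈ Icc 0 t₀, ContDiff ℝ 2 (U t))
    (hUt : ∀ t ∈ Icc 0 t₀, ∀ x,
      HasDerivAt (fun s => U s x) (lap N (U t) x + U t x ^ (α + 1)) t)
    {f : EuclideanSpace ℝ (Fin N) → ℝ} (hf : Continuous f) (hfc : HasCompactSupport f)
    (hfU : ∀ x, f x ≤ U 0 x) (t₁ : ℝ) (ht₁ : t₁ ∈ Icc 0 t₀) (x₁ : EuclideanSpace ℝ (Fin N)) :
    heatV N f t₁ x₁ ≤ U t₁ x₁ * (1 + α * t₁ * U t₁ x₁ ^ α) ^ (-(1 / α)) := by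
  by_contra hcon
  push Not at hcon
  obtain ⟨M, hM⟩ := hfc.exists_bound_of_continuous hf
  set z : ℝ → EuclideanSpace ℝ (Fin N) → ℝ :=
    fun t x => U t x * (1 + α * t * U t x ^ α) ^ (-(1 / α)) with hz
  have hz0 : ∀ t ∈ Icc 0 t₀, ∀ x, 0 ≤ z t x := by
    intro t ht x
    have h1 := hU0 t ht x
    have h2 := ht.1
    simp only [hz]; positivity
  set P : ℝ → EuclideanSpace ℝ (Fin N) → ℝ := fun t x => ‖x‖ ^ 2 + (2 * N + 1) * t with hP
  have hP0 : ∀ t ∈ Icc 0 t₀, ∀ x, 0 ≤ P t x := by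
    intro t ht x
    have h2 := ht.1
    simp only [hP]; positivity
  obtain ⟨ε, hε, hε1⟩ : ∃ ε > 0, ε * P t₁ x₁ < heatV N f t₁ x₁ - z t₁ x₁ := by
    have hgap : 0 < heatV N f t₁ x₁ - z t₁ x₁ := sub_pos.2 hcon
    have hp := hP0 t₁ ht₁ x₁
    refine ⟨(heatV N f t₁ x₁ - z t₁ x₁) / (P t₁ x₁ + 1), by positivity, ?_⟩
    rw [div_mul_eq_mul_div, div_lt_iff₀ (by positivity)]
    nlinarith
  set D : ℝ → EuclideanSpace ℝ (Fin N) → ℝ :=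
    fun t x => z t x - heatV N f t x + ε * P t x with hD
  have hD1 : D t₁ x₁ < 0 := by simp only [hD]; linarith
  -- continuity
  have hDc : ContinuousOn (fun p : ℝ × EuclideanSpace ℝ (Fin N) => D p.1 p.2)
      (Icc 0 t₀ ×ˢ univ) := by
    have hzc : ContinuousOn (fun p : ℝ × EuclideanSpace ℝ (Fin N) => z p.1 p.2)
        (Icc 0 t₀ ×ˢ univ) := by
      simp only [hz]
      refine hUc.mul (ContinuousOn.rpow_const ?_ ?_)
      · refine continuousOn_const.add (ContinuousOn.mul (by fun_prop) ?_)
        exact hUc.rpow_const fun p hp => Or.inr hα.le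
      · intro p hp
        have h1 := hU0 p.1 hp.1 p.2
        have h2 := hp.1.1
        left; positivity
    refine (hzc.sub (heatV_continuous hf hM).continuousOn).add (Continuous.continuousOn ?_)
    simp only [hP]; fun_prop
  -- global minimum
  obtain ⟨t₂, ht₂, x₂, hmin⟩ : ∃ t₂ ∈ Icc 0 t₀, ∃ x₂, D t₂ x₂ < 0 ∧
      ∀ t ∈ Icc 0 t₀, ∀ x, D t₂ x₂ ≤ D t x := by
    set R := ‖x₁‖ + |M| / ε + 1 with hR
    have hR1 : 1 ≤ R := by
      have : 0 ≤ ‖x₁‖ + |M| / ε := by positivity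
      linarith
    have hR2 : M ≤ ε * R := by
      have h1 : |M| / ε ≤ R := by linarith [norm_nonneg x₁]
      rw [div_le_iff₀ hε] at h1
      linarith [le_abs_self M]
    have hK : IsCompact (Icc 0 t₀ ×ˢ Metric.closedBall (0 : EuclideanSpace ℝ (Fin N)) R) :=
      isCompact_Icc.prod (isCompact_closedBall _ _)
    have hin : (t₁, x₁) ∈ Icc 0 t₀ ×ˢ Metric.closedBall (0 : EuclideanSpace ℝ (Fin N)) R := by
      refine ⟨ht₁, ?_⟩
      have : 0 ≤ |M| / ε := by positivity
      simp only [mem_closedBall_zero_iff]; linarith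
    obtain ⟨p, hp, hpm⟩ := hK.exists_isMinOn ⟨_, hin⟩
      (hDc.mono (prod_mono subset_rfl (subset_univ _)))
    have hp1 : D p.1 p.2 ≤ D t₁ x₁ := hpm hin
    refine ⟨p.1, hp.1, p.2, by linarith, fun t ht x => ?_⟩
    by_cases hx : x ∈ Metric.closedBall (0 : EuclideanSpace ℝ (Fin N)) R
    · exact hpm (show (t, x) ∈ _ from ⟨ht, hx⟩)
    · simp only [mem_closedBall_zero_iff, not_le] at hx
      have h1 := heatV_le hM t x
      have h2 := hz0 t ht x
      have h3 : R ≤ P t x := by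
        have := ht.1
        have h4 : 0 ≤ (2 * (N : ℝ) + 1) * t := by positivity
        simp only [hP]
        nlinarith
      have h5 : ε * R ≤ ε * P t x := mul_le_mul_of_nonneg_left h3 hε.le
      have : 0 ≤ D t x := by simp only [hD]; linarith
      linarith
  obtain ⟨hneg, hmin⟩ := hmin
  have ht₂0 : 0 < t₂ := by
    rcases ht₂.1.eq_or_lt with h | h
    · exfalso
      rw [← h] at hneg
      have h1 := hfU x₂
      have h2 := hP0 0 (h ▸ ht₂) x₂
      have h3 : 0 ≤ ε * P 0 x₂ := by positivity
      simp only [hD, heatV_zero] at hneg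
      have h4 : z 0 x₂ = U 0 x₂ := by simp [hz]
      linarith
    · exact h
  -- replace by the tangent
  set p := U t₂ x₂ with hp
  have hp0 : 0 ≤ p := hU0 t₂ ht₂ x₂
  set A : ℝ → ℝ := fun t => (1 + α * t * p ^ α) ^ (-(1 / α) - 1) with hA
  set E : ℝ → EuclideanSpace ℝ (Fin N) → ℝ :=
    fun t x => A t * (U t x + α * t * p ^ (α + 1)) - heatV N f t x + ε * P t x with hE
  have hE2 : E t₂ x₂ = D t₂ x₂ := by
    simp only [hE, hD, hz, hA]
    rw [← hp, tangent_eq hα (by positivity) hp0]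
  have hEmin : ∀ t ∈ Icc 0 t₀, ∀ x, E t₂ x₂ ≤ E t x := by
    intro t ht x
    have h1 := ht.1
    have h2 := tangent_ineq hα (show 0 ≤ α * t by positivity) (hU0 t ht x) hp0
    have h3 := hmin t ht x
    rw [hE2]
    refine h3.trans ?_
    simp only [hE, hD, hz, hA]
    linarith
  -- time derivative
  have hq : 0 < 1 + α * t₂ * p ^ α := by positivity
  have hAt : HasDerivAt A (α * 1 * p ^ α * (-(1 / α) - 1) *
      (1 + α * t₂ * p ^ α) ^ (-(1 / α) - 1 - 1)) t₂ := by
    have h := (((hasDerivAt_id t₂).const_mul α).mul_const (p ^ α)).const_add 1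
    exact h.rpow_const (Or.inl hq.ne')
  set L := ∫ y, heatKernel N t₂ x₂ y * (‖x₂ - y‖ ^ 2 / (4 * t₂ ^ 2) - N / (2 * t₂)) * f y with hL
  have hEt : HasDerivAt (fun t => E t x₂)
      (A t₂ * lap N (U t₂) x₂ - L + ε * (2 * N + 1)) t₂ := by
    have h1 := hUt t₂ ht₂ x₂
    have h2 := h1.add (((hasDerivAt_id t₂).const_mul α).mul_const (p ^ (α + 1)))
    have h3 := ((hAt.mul h2).sub (heatV_deriv_t hf hfc ht₂0 x₂)).add
      ((((hasDerivAt_id t₂).const_mul (2 * (N : ℝ) + 1)).const_add (‖x₂‖ ^ 2)).const_mul ε)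
    convert! h3 using 1
    simp only [id, Pi.add_apply]
    rw [← hp, ← hL, rpow_sub_one hq.ne', rpow_add_one' hp0 (by positivity)]
    simp only [hA]
    field_simp
    ring
  have hT := deriv_nonpos_of_left_min ht₂0 hEt
    (fun s hs => hEmin s ⟨hs.1, hs.2.trans ht₂.2⟩ x₂)
  -- space derivative
  have hS : ∀ i : Fin N, 0 ≤ A t₂ * iteratedFDeriv ℝ 2 (U t₂) x₂
      ![EuclideanSpace.single i 1, EuclideanSpace.single i 1] -
      (∫ y, heatKernel N t₂ (x₂ + (0 : ℝ) • EuclideanSpace.single i (1 : ℝ)) y *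
        ((-(2 * (x₂ - y) i + 2 * 0) / (4 * t₂)) ^ 2 - 2 / (4 * t₂)) * f y) + ε * (2 * 1) := by
    intro i
    have d1 := fun r : ℝ => ((((line_deriv (hU2 t₂ ht₂) x₂ (EuclideanSpace.single i 1) r).add_const
      (α * t₂ * p ^ (α + 1))).const_mul (A t₂)).sub (heatV_deriv_r hf hfc ht₂0 x₂ i r)).add
      (((norm_line_deriv x₂ i r).add_const ((2 * (N : ℝ) + 1) * t₂)).const_mul ε)
    have d2 := (((line_deriv2 (hU2 t₂ ht₂) x₂ (EuclideanSpace.single i 1)).const_mul (A t₂)).sub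
      (heatV_deriv_rr hf hfc (t := t₂) x₂ i 0)).add
      ((((hasDerivAt_id (0 : ℝ)).const_mul 2).const_add (2 * x₂ i)).const_mul ε)
    refine second_deriv_nonneg d1 d2 (fun r => ?_)
    have := hEmin t₂ ht₂ (x₂ + r • EuclideanSpace.single i 1)
    simpa [hE, hP] using this
  have hsum := Finset.sum_nonneg (fun i (_ : i ∈ Finset.univ) => hS i)
  rw [Finset.sum_add_distrib, Finset.sum_sub_distrib, heatV_lap hf hfc ht₂0, ← Finset.mul_sum] at hsum
  simp only [Finset.sum_const, Finset.card_univ, Fintype.card_fin, nsmul_eq_mul] at hsum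
  change 0 ≤ A t₂ * lap N (U t₂) x₂ - L + _ at hsum
  nlinarith

lemma cutoff_bound {N : ℕ} {α : ℝ} (hα : 0 < α) {T : ℝ}
    {u : ℝ → ZeroAtInftyContinuousMap (EuclideanSpace ℝ (Fin N)) ℝ}
    (hc : ContinuousOn u (Ioo 0 T))
    (h0 : ∀ t ∈ Ioo 0 T, ∀ x, 0 ≤ u t x)
    (h2 : ∀ t ∈ Ioo 0 T, ContDiff ℝ 2 (fun x => u t x))
    (ht : ∀ t ∈ Ioo 0 T, ∀ x, HasDerivAt (fun s => u s x)
        (lap N (fun y => u t y) x + u t x ^ (α + 1)) t)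
    {s t : ℝ} (hs : 0 < s) (htp : 0 < t) (hst : s + t < T)
    {f : EuclideanSpace ℝ (Fin N) → ℝ} (hf : Continuous f) (hfc : HasCompactSupport f)
    (hf0 : ∀ x, 0 ≤ f x)
    (hfu : ∀ x, f x ≤ u s x) (x : EuclideanSpace ℝ (Fin N)) :
    ∫⁻ y, ENNReal.ofReal (heatKernel N t x y * f y) ≤
      ENNReal.ofReal (((α * t) ^ (1 / α))⁻¹) := by
  have hI : ∀ σ ∈ Icc 0 t, s + σ ∈ Ioo 0 T := fun σ hσ =>
    ⟨by linarith [hσ.1], by linarith [hσ.2]⟩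
  have hev : ContinuousOn (fun p : ℝ × EuclideanSpace ℝ (Fin N) => u (s + p.1) p.2)
      (Icc 0 t ×ˢ univ) := by
    have e1 : ContinuousOn (fun p : ℝ × EuclideanSpace ℝ (Fin N) => u (s + p.1))
        (Icc 0 t ×ˢ univ) :=
      hc.comp (f := fun p : ℝ × EuclideanSpace ℝ (Fin N) => s + p.1) (by fun_prop)
        (fun p hp => hI p.1 hp.1)
    have e2 : ContinuousOn (fun p : ℝ × EuclideanSpace ℝ (Fin N) => (u (s + p.1)).toBCF)
        (Icc 0 t ×ˢ univ) :=
      ZeroAtInftyContinuousMap.isometry_toBCF.continuous.comp_continuousOn e1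
    exact e2.eval continuousOn_snd
  have key := comparison hα (t₀ := t) (fun σ x => u (s + σ) x) hev
    (fun σ hσ x => h0 _ (hI σ hσ) x) (fun σ hσ => h2 _ (hI σ hσ))
    (fun σ hσ x => (ht _ (hI σ hσ) x).comp_const_add s σ) hf hfc (by simpa using hfu) t
    ⟨htp.le, le_rfl⟩ x
  have hzb := z_bound hα htp (h0 _ (hI t ⟨htp.le, le_rfl⟩) x)
  have hpos : 0 < (α * t) ^ (1 / α) := by positivity
  have hV : heatV N f t x ≤ ((α * t) ^ (1 / α))⁻¹ := by
    refine key.trans ?_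
    rw [← one_div, le_div_iff₀ hpos, mul_comm]
    exact hzb
  rw [← ofReal_integral_eq_lintegral_ofReal, ← heatV_eq f htp x]
  · exact ENNReal.ofReal_le_ofReal hV
  · exact ((hk_continuous N t x).mul hf).integrable_of_hasCompactSupport hfc.mul_left
  · exact Eventually.of_forall fun y => mul_nonneg (hk_nonneg N htp.le x y) (hf0 y)

/-- If `limsup_{t↓0} (αt)^{1/α} ess sup_x (e^{tΔ}u₀)(x) > 1`, then for no
`T > 0` does there exist a nonnegative regular solution of `u_t = Δu + u^{α+1}` on
`(0,T) × ℝ^N` with initial value `u₀`. -/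
theorem stmt1 (N : ℕ) (hN : 1 ≤ N) (α : ℝ) (hα : 0 < α)
    (u₀ : EuclideanSpace ℝ (Fin N) → ℝ) (hu₀m : Measurable u₀) (hu₀ : ∀ x, 0 ≤ u₀ x)
    (hlimsup : 1 < Filter.limsup (fun t : ℝ =>
      ENNReal.ofReal ((α * t) ^ (1 / α)) *
        essSup (fun x => ∫⁻ y, ENNReal.ofReal (heatKernel N t x y * u₀ y)) volume)
      (nhdsWithin 0 (Ioi 0))) :
    ∀ T > (0 : ℝ), ¬ ∃ u : ℝ → ZeroAtInftyContinuousMap (EuclideanSpace ℝ (Fin N)) ℝ,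
      -- `u ∈ C((0,T), C₀(ℝ^N))`
      ContinuousOn u (Ioo 0 T) ∧
      -- `u ≥ 0`
      (∀ t ∈ Ioo 0 T, ∀ x, 0 ≤ u t x) ∧
      -- `u` is `C²` in `x`
      (∀ t ∈ Ioo 0 T, ContDiff ℝ 2 (fun x => u t x)) ∧
      -- `u` is `C¹` in `t`
      (∀ x, ContDiffOn ℝ 1 (fun s => u s x) (Ioo 0 T)) ∧
      -- the equation `∂_t u = Δu + u^{α+1}` holds pointwise on `(0,T) × ℝ^N`
      (∀ t ∈ Ioo 0 T, ∀ x, HasDerivAt (fun s => u s x)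
        (lap N (fun y => u t y) x + u t x ^ (α + 1)) t) ∧
      -- there is a sequence `t_n ↓ 0` with `u(t_n, ·) → u₀` almost everywhere
      ∃ tseq : ℕ → ℝ, (∀ n, tseq n ∈ Ioo 0 T) ∧ StrictAnti tseq ∧
        Filter.Tendsto tseq Filter.atTop (nhds 0) ∧
        ∀ᵐ x ∂volume, Filter.Tendsto (fun n => u (tseq n) x) Filter.atTop (nhds (u₀ x)) := by
  rintro T hT ⟨u, hc, h0, h2, -, ht, tseq, hts, -, htl, hae⟩
  have main : ∀ t ∈ Ioo 0 T, ∀ x, ∫⁻ y, ENNReal.ofReal (heatKernel N t x y * u₀ y) ≤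
      ENNReal.ofReal (((α * t) ^ (1 / α))⁻¹) := by
    intro t htT x
    set χ : ℕ → EuclideanSpace ℝ (Fin N) → ℝ := fun n y => max 0 (min 1 (n + 1 - ‖y‖)) with hχ
    set f : ℕ → EuclideanSpace ℝ (Fin N) → ℝ := fun n y => χ n y * u (tseq n) y with hf
    have hχ0 : ∀ n y, 0 ≤ χ n y := fun n y => le_max_left _ _
    have hχ1 : ∀ n y, χ n y ≤ 1 := fun n y => max_le zero_le_one (min_le_left _ _)
    have hχc : ∀ n, Continuous (χ n) := by intro n; simp only [hχ]; fun_prop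
    have hχs : ∀ n, HasCompactSupport (χ n) := by
      intro n
      refine HasCompactSupport.intro
        (isCompact_closedBall (0 : EuclideanSpace ℝ (Fin N)) (n + 1)) fun y hy => ?_
      simp only [mem_closedBall_zero_iff, not_le] at hy
      exact max_eq_left ((min_le_right _ _).trans (by linarith))
    have hfc : ∀ n, Continuous (f n) := fun n => (hχc n).mul (u (tseq n)).continuous
    have hlim : ∀ᵐ y ∂volume, ENNReal.ofReal (heatKernel N t x y * u₀ y) =
        liminf (fun n => ENNReal.ofReal (heatKernel N t x y * f n y)) atTop := by
      filter_upwards [hae] with y hy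
      refine (Tendsto.liminf_eq ?_).symm
      refine ENNReal.tendsto_ofReal (Tendsto.const_mul _ ?_)
      refine hy.congr' ?_
      filter_upwards [eventually_ge_atTop ⌈‖y‖⌉₊] with n hn
      have h1 : ‖y‖ ≤ n := Nat.ceil_le.1 hn
      have h3 : χ n y = 1 := by
        simp only [hχ]
        rw [min_eq_left (by linarith), max_eq_right zero_le_one]
      simp only [hf, h3, one_mul]
    rw [lintegral_congr_ae hlim]
    refine (lintegral_liminf_le fun n => ?_).trans ?_
    · exact (((hk_continuous N t x).mul (hfc n)).measurable).ennreal_ofReal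
    refine liminf_le_of_frequently_le' (Eventually.frequently ?_)
    have hev : ∀ᶠ n in atTop, tseq n < T - t :=
      htl.eventually (gt_mem_nhds (by linarith [htT.2]))
    filter_upwards [hev] with n hn
    refine cutoff_bound hα hc h0 h2 ht (hts n).1 htT.1 (by linarith) (hfc n)
      (hχs n).mul_right (fun y => mul_nonneg (hχ0 n y) (h0 _ (hts n) y)) (fun y => ?_) x
    exact mul_le_of_le_one_left (h0 _ (hts n) y) (hχ1 n y)
  refine absurd hlimsup (not_lt.2 ?_)
  refine limsup_le_of_le (h := ?_)
  filter_upwards [Ioo_mem_nhdsGT hT] with t htT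
  have hpos : 0 < (α * t) ^ (1 / α) := by have := htT.1; positivity
  calc _ ≤ ENNReal.ofReal ((α * t) ^ (1 / α)) * ENNReal.ofReal (((α * t) ^ (1 / α))⁻¹) := by
        gcongr
        exact essSup_le_of_ae_le _ (Eventually.of_forall fun x => main t htT x)
    _ = 1 := by
        rw [← ENNReal.ofReal_mul hpos.le, mul_inv_cancel₀ hpos.ne', ENNReal.ofReal_one]
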